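/- arXiv:1603.00384 — 2 statements merged into one kernel-verified Lean document; each statement's English description precedes it below -/
import Mathlib

section
/- Let d ≥ 1 and let D' be a Delone set in ℝ^d that is a boundedly displaced image of ℤ^d, i.e., there exists a bijection Ψ : ℤ^d → D' and a constant M such that ‖Ψ(z) − z‖ ≤ M for all z ∈ ℤ^d. Then there exists a bi-Lipschitz homeomorphism F : ℝ^d → ℝ^d such that F(D') = ℤ^d. -/
/-- The integer lattice ℤ^d inside `EuclideanSpace ℝ (Fin d)`:
the set of points all of whose coordinates are integers. -/
def intLattice (d : ℕ) : Set (EuclideanSpace ℝ (Fin d)) :=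
  {x | ∀ i : Fin d, ∃ n : ℤ, x i = (n : ℝ)}

open Set Function
open scoped NNReal

/-- The group of bi-Lipschitz homeomorphisms of a metric space. -/
def biLipschitzGroup (X : Type*) [MetricSpace X] : Subgroup (Equiv.Perm X) where
  carrier := {f | (∃ K : ℝ≥0, LipschitzWith K f) ∧ ∃ K : ℝ≥0, LipschitzWith K f.symm}
  one_mem' := ⟨⟨1, LipschitzWith.id⟩, ⟨1, LipschitzWith.id⟩⟩
  mul_mem' := by
    rintro f g ⟨⟨K, hK⟩, K', hK'⟩ ⟨⟨L, hL⟩, L', hL'⟩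
    exact ⟨⟨K * L, hK.comp hL⟩, ⟨L' * K', hL'.comp hK'⟩⟩
  inv_mem' := by
    rintro f ⟨h, h'⟩
    exact ⟨h', h⟩

lemma addRight_mem_biLipschitzGroup {E : Type*} [NormedAddCommGroup E] (a : E) :
    Equiv.addRight a ∈ biLipschitzGroup E :=
  ⟨⟨1, (isometry_add_right a).lipschitz⟩, ⟨1, (isometry_add_right (-a)).lipschitz⟩⟩

section Perturbation

variable {E : Type*} [NormedAddCommGroup E]

lemma bijective_add_of_contracting [CompleteSpace E] {g : E → E} {c : ℝ≥0} (hc : c < 1)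
    (hg : LipschitzWith c g) : Bijective fun x => x + g x := by
  constructor
  · have h := (AntilipschitzWith.id (α := E)).add_lipschitzWith hg (by simpa using hc)
    exact h.injective
  · intro y
    have hcontr : ContractingWith c fun x => y - g x := by
      refine ⟨hc, LipschitzWith.of_dist_le_mul fun a b => ?_⟩
      rw [dist_sub_left]
      exact hg.dist_le_mul a b
    refine ⟨hcontr.fixedPoint, ?_⟩
    have h : y - g hcontr.fixedPoint = hcontr.fixedPoint := hcontr.fixedPoint_isFixedPt
    exact (sub_eq_iff_eq_add.1 h).symm

/-- A perturbation of the identity by a contraction is a bi-Lipschitz homeomorphism. -/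
lemma exists_biLipschitz_add_contracting [CompleteSpace E] {g : E → E} {c : ℝ≥0} (hc : c < 1)
    (hg : LipschitzWith c g) : ∃ f ∈ biLipschitzGroup E, ∀ x, f x = x + g x := by
  let f := Equiv.ofBijective _ (bijective_add_of_contracting hc hg)
  have h := (AntilipschitzWith.id (α := E)).add_lipschitzWith hg (by simpa using hc)
  exact ⟨f, ⟨⟨1 + c, LipschitzWith.id.add hg⟩, ⟨_, h.to_rightInverse f.right_inv⟩⟩, fun x => rfl⟩

/-- The points of a uniformly discrete set can be displaced arbitrarily, as long as the
displacements are small enough, by a bi-Lipschitz homeomorphism. -/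
lemma exists_biLipschitz_displacing [NormedSpace ℝ E] [FiniteDimensional ℝ E] {S : Set E} {r : ℝ} (hr : 0 < r)
    (hS : ∀ x ∈ S, ∀ y ∈ S, x ≠ y → r ≤ dist x y) :
    ∃ η : ℝ, 0 < η ∧ ∀ v : E → E, (∀ x ∈ S, ‖v x‖ ≤ η) →
      ∃ f ∈ biLipschitzGroup E, ∀ x ∈ S, f x = x + v x := by
  have : CompleteSpace E := FiniteDimensional.complete ℝ E
  set C := lipschitzExtensionConstant E
  have hC : 0 < C := lipschitzExtensionConstant_pos E
  let r' : ℝ≥0 := ⟨r, hr.le⟩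
  have hr' : 0 < r' := hr
  let η : ℝ≥0 := r' / (4 * C)
  have hη : 0 < η := by positivity
  refine ⟨η, hη, fun v hv => ?_⟩
  have hlip : LipschitzOnWith (2 * η / r') v S := by
    refine LipschitzOnWith.of_dist_le_mul fun x hx y hy => ?_
    rcases eq_or_ne x y with rfl | hxy
    · simp
    · have h1 : dist (v x) (v y) ≤ 2 * η := by
        rw [dist_eq_norm]
        linarith [norm_sub_le (v x) (v y), hv x hx, hv y hy]
      have h2 := hS x hx y hy hxy
      have h3 : ((2 * η / r' : ℝ≥0) : ℝ) = 2 * η / r := by push_cast; rfl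
      rw [h3]
      have h4 : 2 * (η : ℝ) / r * r = 2 * η := by field_simp
      calc dist (v x) (v y) ≤ 2 * (η : ℝ) / r * r := by rw [h4]; exact h1
        _ ≤ _ := by gcongr
  obtain ⟨g, hg, hgv⟩ := hlip.extend_finite_dimension
  have hlt : C * (2 * η / r') < 1 := by
    have : C * (2 * η / r') = 1 / 2 := by
      simp only [η]
      field_simp
      norm_num
    rw [this]
    exact NNReal.coe_lt_coe.1 (by norm_num)
  obtain ⟨f, hf, hfg⟩ := exists_biLipschitz_add_contracting hlt hg
  exact ⟨f, hf, fun x hx => by rw [hfg, hgv hx]⟩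

end Perturbation

section Gluing

variable {X I : Type*}

open Classical in
/-- The map which applies `f i` to the points moved by `f i`, for each `i`. -/
noncomputable def glue (f : I → X → X) (x : X) : X :=
  if h : ∃ i, f i x ≠ x then f h.choose x else x

lemma glue_eq_self {f : I → X → X} {x : X} (h : ∀ i, f i x = x) : glue f x = x := by
  simp [glue, h]

variable [MetricSpace X] {f : I → Equiv.Perm X} {c : I → X} {ρ : ℝ}

lemma glue_eq_of_dist_lt {f : I → X → X} (hc : ∀ i j, i ≠ j → 3 * ρ ≤ dist (c i) (c j))
    (hf : ∀ i x, ρ ≤ dist x (c i) → f i x = x) {i : I} {x : X} (hx : dist x (c i) < 2 * ρ) :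
    glue f x = f i x := by
  have key : ∀ j, f j x ≠ x → j = i := by
    intro j hj
    by_contra hji
    have h1 : dist x (c j) < ρ := not_le.1 fun h => hj (hf j x h)
    linarith [hc j i hji, dist_triangle_left (c j) (c i) x]
  unfold glue
  split_ifs with h
  · rw [key _ h.choose_spec]
  · push Not at h
    exact (h i).symm

lemma dist_apply_lt {f : Equiv.Perm X} {c : X} (hf : ∀ x, ρ ≤ dist x c → f x = x) {x : X}
    (hx : dist x c < ρ) : dist (f x) c < ρ := by
  by_contra! h
  have h1 := f.injective (hf _ h)
  rw [h1] at h
  linarith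

lemma lipschitzWith_glue (hρ : 0 < ρ) {K : ℝ≥0}
    (hc : ∀ i j, i ≠ j → 3 * ρ ≤ dist (c i) (c j))
    (hf : ∀ i x, ρ ≤ dist x (c i) → f i x = x) (hK : ∀ i, LipschitzWith K (f i)) :
    LipschitzWith (K + 5) (glue fun i => f i) := by
  have hdisp : ∀ x, dist (glue (fun i => f i) x) x ≤ 2 * ρ := by
    intro x
    by_cases h : ∃ i, dist x (c i) < ρ
    · obtain ⟨i, hi⟩ := h
      rw [glue_eq_of_dist_lt hc hf (i := i) (by linarith)]
      linarith [dist_apply_lt (hf i) hi, dist_triangle_right (f i x) x (c i)]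
    · push Not at h
      rw [glue_eq_self fun i => hf i x (h i), dist_self]
      positivity
  have hnear : ∀ x y i, dist x y < ρ → dist x (c i) < ρ →
      dist (glue (fun i => f i) x) (glue (fun i => f i) y) ≤ (K + 5) * dist x y := by
    intro x y i hxy hx
    rw [glue_eq_of_dist_lt hc hf (i := i) (by linarith),
      glue_eq_of_dist_lt hc hf (i := i) (by linarith [dist_triangle_left y (c i) x])]
    linarith [(hK i).dist_le_mul x y, dist_nonneg (x := x) (y := y)]
  refine LipschitzWith.of_dist_le_mul fun x y => ?_
  push_cast
  rcases lt_or_ge (dist x y) ρ with hxy | hxy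
  · by_cases h : ∃ i, dist x (c i) < ρ
    · obtain ⟨i, hi⟩ := h
      exact hnear x y i hxy hi
    · by_cases h' : ∃ i, dist y (c i) < ρ
      · obtain ⟨i, hi⟩ := h'
        rw [dist_comm x y] at hxy ⊢
        rw [dist_comm (glue _ x)]
        exact hnear y x i hxy hi
      · push Not at h h'
        rw [glue_eq_self fun i => hf i x (h i), glue_eq_self fun i => hf i y (h' i)]
        nlinarith [dist_nonneg (x := x) (y := y), K.coe_nonneg]
  · have h1 := dist_triangle4 (glue (fun i => f i) x) x y (glue (fun i => f i) y)
    have h2 := hdisp x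
    have h3 := hdisp y
    rw [dist_comm] at h3
    nlinarith [mul_nonneg K.coe_nonneg (dist_nonneg (x := x) (y := y))]

lemma glue_leftInverse (hρ : 0 < ρ) (hc : ∀ i j, i ≠ j → 3 * ρ ≤ dist (c i) (c j))
    (hf : ∀ i x, ρ ≤ dist x (c i) → f i x = x)
    (hf' : ∀ i x, ρ ≤ dist x (c i) → (f i).symm x = x) :
    LeftInverse (glue fun i => (f i).symm) (glue fun i => f i) := by
  intro x
  by_cases h : ∃ i, dist x (c i) < ρ
  · obtain ⟨i, hi⟩ := h
    rw [glue_eq_of_dist_lt hc hf (i := i) (by linarith),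
      glue_eq_of_dist_lt hc hf' (i := i) (by linarith [dist_apply_lt (hf i) hi])]
    simp
  · push Not at h
    rw [glue_eq_self fun i => hf i x (h i), glue_eq_self fun i => hf' i x (h i)]

/-- Uniformly bi-Lipschitz homeomorphisms supported in well separated balls of equal radius can
be applied simultaneously. -/
lemma exists_biLipschitz_glue (hρ : 0 < ρ) {K : ℝ≥0}
    (hc : ∀ i j, i ≠ j → 3 * ρ ≤ dist (c i) (c j))
    (hf : ∀ i x, ρ ≤ dist x (c i) → f i x = x) (hK : ∀ i, LipschitzWith K (f i))
    (hK' : ∀ i, LipschitzWith K (f i).symm) :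
    ∃ F ∈ biLipschitzGroup X, (∀ i x, f i x ≠ x → F x = f i x) ∧
      ∀ x, (∀ i, f i x = x) → F x = x := by
  have hf' : ∀ i x, ρ ≤ dist x (c i) → (f i).symm x = x := fun i x h => by
    rw [Equiv.symm_apply_eq, hf i x h]
  refine ⟨⟨glue fun i => f i, glue fun i => (f i).symm, glue_leftInverse hρ hc hf hf',
    glue_leftInverse (f := fun i => (f i).symm) hρ hc hf' hf⟩,
    ⟨⟨_, lipschitzWith_glue hρ hc hf hK⟩,
      ⟨_, lipschitzWith_glue (f := fun i => (f i).symm) hρ hc hf' hK'⟩⟩, fun i x h => ?_,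
    fun x h => glue_eq_self h⟩
  have : dist x (c i) < ρ := not_le.1 fun h' => h (hf i x h')
  exact glue_eq_of_dist_lt hc hf (by linarith)

end Gluing

section Twist

variable {E : Type*} [NormedAddCommGroup E] [InnerProductSpace ℝ E]

/-- The rotation by the angle `θ` in the plane spanned by the orthonormal vectors `u` and `v`,
acting trivially on the orthogonal complement. -/
noncomputable def planeRotation (u v : E) (θ : ℝ) (x : E) : E :=
  x + (((Real.cos θ - 1) * inner ℝ u x - Real.sin θ * inner ℝ v x) • u +
    (Real.sin θ * inner ℝ u x + (Real.cos θ - 1) * inner ℝ v x) • v)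

lemma planeRotation_zero (u v x : E) : planeRotation u v 0 x = x := by
  simp [planeRotation]

lemma planeRotation_sub (u v : E) (θ : ℝ) (x y : E) :
    planeRotation u v θ (x - y) = planeRotation u v θ x - planeRotation u v θ y := by
  simp only [planeRotation, inner_sub_right]
  module

variable {u v : E}

lemma planeRotation_pi_smul (hu : ‖u‖ = 1) (huv : inner ℝ u v = 0) (a : ℝ) :
    planeRotation u v Real.pi (a • u) = -(a • u) := by
  have huu : inner ℝ u u = (1 : ℝ) := by simp [hu]
  have hvu : inner ℝ v u = (0 : ℝ) := by rw [real_inner_comm, huv]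
  simp only [planeRotation, inner_smul_right, huu, hvu, Real.cos_pi, Real.sin_pi]
  module

lemma norm_planeRotation (hu : ‖u‖ = 1) (hv : ‖v‖ = 1) (huv : inner ℝ u v = 0) (θ : ℝ) (x : E) :
    ‖planeRotation u v θ x‖ = ‖x‖ := by
  have huu : inner ℝ u u = (1 : ℝ) := by simp [hu]
  have hvv : inner ℝ v v = (1 : ℝ) := by simp [hv]
  have hvu : inner ℝ v u = (0 : ℝ) := by rw [real_inner_comm, huv]
  rw [← sq_eq_sq₀ (norm_nonneg _) (norm_nonneg _), ← real_inner_self_eq_norm_sq,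
    ← real_inner_self_eq_norm_sq]
  simp only [planeRotation, inner_add_left, inner_add_right, inner_smul_left, inner_smul_right,
    huu, hvv, huv, hvu, real_inner_comm u x, real_inner_comm v x, RCLike.conj_to_real]
  linear_combination ((inner ℝ u x) ^ 2 + (inner ℝ v x) ^ 2 : ℝ) * Real.sin_sq_add_cos_sq θ

lemma planeRotation_neg_planeRotation (hu : ‖u‖ = 1) (hv : ‖v‖ = 1) (huv : inner ℝ u v = 0)
    (θ : ℝ) (x : E) : planeRotation u v (-θ) (planeRotation u v θ x) = x := by
  have huu : inner ℝ u u = (1 : ℝ) := by simp [hu]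
  have hvv : inner ℝ v v = (1 : ℝ) := by simp [hv]
  have hvu : inner ℝ v u = (0 : ℝ) := by rw [real_inner_comm, huv]
  simp only [planeRotation, inner_add_right, inner_smul_right, huu, hvv, huv, hvu,
    Real.cos_neg, Real.sin_neg]
  match_scalars
  · ring
  · linear_combination (inner ℝ u x) * Real.sin_sq_add_cos_sq θ
  · linear_combination (inner ℝ v x) * Real.sin_sq_add_cos_sq θ

lemma norm_planeRotation_sub_planeRotation_le (hu : ‖u‖ = 1) (hv : ‖v‖ = 1) (θ θ' : ℝ) (x : E) :
    ‖planeRotation u v θ x - planeRotation u v θ' x‖ ≤ 4 * |θ - θ'| * ‖x‖ := by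
  have hux : |inner ℝ u x| ≤ ‖x‖ := by simpa [hu] using abs_real_inner_le_norm u x
  have hvx : |inner ℝ v x| ≤ ‖x‖ := by simpa [hv] using abs_real_inner_le_norm v x
  have hcos := Real.abs_cos_sub_cos_le θ θ'
  have hsin := Real.abs_sin_sub_sin_le θ θ'
  have heq : planeRotation u v θ x - planeRotation u v θ' x =
      ((Real.cos θ - Real.cos θ') * inner ℝ u x - (Real.sin θ - Real.sin θ') * inner ℝ v x) • u +
      ((Real.sin θ - Real.sin θ') * inner ℝ u x + (Real.cos θ - Real.cos θ') * inner ℝ v x) • v := by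
    simp only [planeRotation]
    module
  have hmul : ∀ a b : ℝ, |a| ≤ |θ - θ'| → |b| ≤ ‖x‖ → |a * b| ≤ |θ - θ'| * ‖x‖ := by
    intro a b ha hb
    rw [abs_mul]
    gcongr
  rw [heq]
  refine (norm_add_le _ _).trans ?_
  rw [norm_smul, norm_smul, hu, hv, mul_one, mul_one, Real.norm_eq_abs, Real.norm_eq_abs]
  linarith [abs_sub ((Real.cos θ - Real.cos θ') * inner ℝ u x)
      ((Real.sin θ - Real.sin θ') * inner ℝ v x),
    abs_add_le ((Real.sin θ - Real.sin θ') * inner ℝ u x)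
      ((Real.cos θ - Real.cos θ') * inner ℝ v x),
    hmul _ _ hcos hux, hmul _ _ hsin hvx, hmul _ _ hsin hux, hmul _ _ hcos hvx]

lemma lipschitzWith_twist (hu : ‖u‖ = 1) (hv : ‖v‖ = 1) (huv : inner ℝ u v = 0) {θ : ℝ → ℝ}
    {L : ℝ≥0} (hθ : LipschitzWith L θ) (hθ' : ∀ t, 1 ≤ t → θ t = 0) :
    LipschitzWith (1 + 4 * L) fun x : E => planeRotation u v (θ ‖x‖) x := by
  have key : ∀ x y : E, ‖y‖ ≤ 1 → dist (planeRotation u v (θ ‖x‖) x)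
      (planeRotation u v (θ ‖y‖) y) ≤ (1 + 4 * L) * dist x y := by
    intro x y hy
    have h1 : dist (planeRotation u v (θ ‖x‖) x) (planeRotation u v (θ ‖x‖) y) = dist x y := by
      rw [dist_eq_norm, ← planeRotation_sub, norm_planeRotation hu hv huv, dist_eq_norm]
    have h2 : dist (planeRotation u v (θ ‖x‖) y) (planeRotation u v (θ ‖y‖) y) ≤
        4 * L * dist x y := by
      rw [dist_eq_norm]
      refine (norm_planeRotation_sub_planeRotation_le hu hv _ _ _).trans ?_
      have h3 : |θ ‖x‖ - θ ‖y‖| ≤ L * dist x y := by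
        have h4 := hθ.dist_le_mul ‖x‖ ‖y‖
        rw [Real.dist_eq, Real.dist_eq] at h4
        refine h4.trans ?_
        rw [dist_eq_norm]
        gcongr
        exact abs_norm_sub_norm_le x y
      nlinarith [abs_nonneg (θ ‖x‖ - θ ‖y‖), norm_nonneg y]
    linarith [dist_triangle (planeRotation u v (θ ‖x‖) x) (planeRotation u v (θ ‖x‖) y)
      (planeRotation u v (θ ‖y‖) y)]
  refine LipschitzWith.of_dist_le_mul fun x y => ?_
  push_cast
  rcases le_total ‖y‖ 1 with hy | hy
  · exact key x y hy
  rcases le_total ‖x‖ 1 with hx | hx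
  · rw [dist_comm, dist_comm x y]
    exact key y x hx
  · rw [hθ' _ hx, hθ' _ hy, planeRotation_zero, planeRotation_zero]
    nlinarith [mul_nonneg L.coe_nonneg (dist_nonneg (x := x) (y := y))]

/-- A cutoff angle, equal to `π` on `[0, 1/2]` and to `0` on `[1, ∞)`. -/
noncomputable def twistAngle (t : ℝ) : ℝ := Real.pi * max 0 (min 1 (2 - 2 * t))

lemma exists_lipschitzWith_twistAngle : ∃ L, LipschitzWith L twistAngle := by
  have h1 : LipschitzWith 2 fun t : ℝ => 2 - 2 * t := by
    refine LipschitzWith.of_dist_le_mul fun a b => le_of_eq ?_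
    rw [dist_sub_left, Real.dist_eq, Real.dist_eq, ← mul_sub, abs_mul]
    simp
  exact ⟨_, (lipschitzWith_smul Real.pi).comp ((h1.const_min 1).const_max 0)⟩

/-- In dimension at least two, there is a bi-Lipschitz homeomorphism supported in a unit ball
which exchanges two antipodal points at distance `1/2` from the center. -/
lemma exists_biLipschitz_twist (hu : ‖u‖ = 1) (hv : ‖v‖ = 1) (huv : inner ℝ u v = 0) (c : E) :
    ∃ f ∈ biLipschitzGroup E, (∀ x, 1 ≤ dist x c → f x = x) ∧
      f (c - (1 / 2 : ℝ) • u) = c + (1 / 2 : ℝ) • u ∧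
      f (c + (1 / 2 : ℝ) • u) = c - (1 / 2 : ℝ) • u := by
  obtain ⟨L, hL⟩ := exists_lipschitzWith_twistAngle
  have hvanish : ∀ t, 1 ≤ t → twistAngle t = 0 := by
    intro t ht
    have : min 1 (2 - 2 * t) ≤ 0 := (min_le_right _ _).trans (by linarith)
    simp [twistAngle, max_eq_left this]
  have hhalf : twistAngle (1 / 2) = Real.pi := by
    norm_num [twistAngle]
  have hinv := planeRotation_neg_planeRotation hu hv huv
  have hnorm := norm_planeRotation hu hv huv
  let T : Equiv.Perm E :=
    { toFun := fun x => planeRotation u v (twistAngle ‖x‖) x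
      invFun := fun x => planeRotation u v (-twistAngle ‖x‖) x
      left_inv := fun x => by simp only [hnorm, hinv]
      right_inv := fun x => by
        simpa only [hnorm, neg_neg] using hinv (-twistAngle ‖x‖) x }
  have hT : T ∈ biLipschitzGroup E :=
    ⟨⟨_, lipschitzWith_twist hu hv huv hL hvanish⟩,
      ⟨_, lipschitzWith_twist (θ := fun t => -twistAngle t) hu hv huv hL.neg
        (by simpa using hvanish)⟩⟩
  have happ : ∀ x, (Equiv.addRight c * T * Equiv.addRight (-c)) x =
      planeRotation u v (twistAngle ‖x - c‖) (x - c) + c := fun x => by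
    simp [T, sub_eq_add_neg]
  refine ⟨Equiv.addRight c * T * Equiv.addRight (-c),
    mul_mem (mul_mem (addRight_mem_biLipschitzGroup c) hT)
      (addRight_mem_biLipschitzGroup (-c)), fun x hx => ?_, ?_, ?_⟩
  · rw [happ, hvanish _ (by rwa [← dist_eq_norm]), planeRotation_zero, sub_add_cancel]
  · have h1 : c - (1 / 2 : ℝ) • u - c = (-(1 / 2) : ℝ) • u := by module
    have h2 : ‖(-(1 / 2) : ℝ) • u‖ = 1 / 2 := by norm_num [norm_smul, hu]
    rw [happ, h1, h2, hhalf, planeRotation_pi_smul hu huv]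
    module
  · have h1 : c + (1 / 2 : ℝ) • u - c = (1 / 2 : ℝ) • u := by module
    have h2 : ‖(1 / 2 : ℝ) • u‖ = 1 / 2 := by norm_num [norm_smul, hu]
    rw [happ, h1, h2, hhalf, planeRotation_pi_smul hu huv]
    module

end Twist

section Lattice

variable {d : ℕ}

/-- The point of `ℝ^d` with the given integer coordinates. -/
def latticePoint (k : Fin d → ℤ) : EuclideanSpace ℝ (Fin d) := WithLp.toLp 2 fun i => (k i : ℝ)

@[simp] lemma latticePoint_apply (k : Fin d → ℤ) (i : Fin d) : latticePoint k i = k i := rfl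

lemma latticePoint_injective : Injective (latticePoint (d := d)) := by
  intro k l h
  ext i
  have := congrArg (fun x : EuclideanSpace ℝ (Fin d) => x i) h
  simpa using this

lemma latticePoint_add (k l : Fin d → ℤ) :
    latticePoint (k + l) = latticePoint k + latticePoint l := by
  ext i
  simp

lemma latticePoint_sub (k l : Fin d → ℤ) :
    latticePoint (k - l) = latticePoint k - latticePoint l := by
  ext i
  simp

lemma intLattice_eq_range : intLattice d = range latticePoint := by
  ext x
  constructor
  · intro h
    choose k hk using h
    exact ⟨k, by ext i; simp [hk]⟩
  · rintro ⟨k, rfl⟩ i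
    exact ⟨k i, rfl⟩

lemma abs_apply_le_norm (x : EuclideanSpace ℝ (Fin d)) (i : Fin d) : |x i| ≤ ‖x‖ :=
  PiLp.norm_apply_le x i

/-- The permutations of `ℤ^d` induced by compactly supported bi-Lipschitz homeomorphisms. -/
def inducedPerms (d : ℕ) : Submonoid (Equiv.Perm (Fin d → ℤ)) where
  carrier := {σ | ∃ f ∈ biLipschitzGroup (EuclideanSpace ℝ (Fin d)),
    (∃ ρ : ℝ, ∀ x, ρ ≤ ‖x‖ → f x = x) ∧ ∀ m, f (latticePoint m) = latticePoint (σ m)}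
  one_mem' := ⟨1, one_mem _, ⟨0, fun _ _ => rfl⟩, fun _ => rfl⟩
  mul_mem' := by
    rintro σ τ ⟨f, hf, ⟨ρ, hρ⟩, hfσ⟩ ⟨g, hg, ⟨ρ', hρ'⟩, hgτ⟩
    refine ⟨f * g, mul_mem hf hg, ⟨max ρ ρ', fun x hx => ?_⟩, fun m => ?_⟩
    · rw [Equiv.Perm.mul_apply, hρ' x ((le_max_right _ _).trans hx),
        hρ x ((le_max_left _ _).trans hx)]
    · rw [Equiv.Perm.mul_apply, hgτ, hfσ, Equiv.Perm.mul_apply]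

lemma one_le_dist_midpoint {p m : Fin d → ℤ} {i : Fin d} (hmp : m ≠ p)
    (hmq : m ≠ p + Pi.single i 1) :
    1 ≤ dist (latticePoint m) (latticePoint p + (1 / 2 : ℝ) • EuclideanSpace.single i (1 : ℝ)) := by
  rw [dist_eq_norm]
  by_cases h : ∃ l, l ≠ i ∧ m l ≠ p l
  · obtain ⟨l, hli, hl⟩ := h
    refine le_trans ?_ (abs_apply_le_norm _ l)
    have : (1 : ℤ) ≤ |m l - p l| := Int.one_le_abs (sub_ne_zero.2 hl)
    have h' : (1 : ℝ) ≤ |(m l : ℝ) - p l| := by exact_mod_cast this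
    simpa [hli] using h'
  · push Not at h
    refine le_trans ?_ (abs_apply_le_norm _ i)
    have h0 : m i ≠ p i := fun h0 => hmp <| by
      ext l
      rcases eq_or_ne l i with rfl | hl
      exacts [h0, h l hl]
    have h1 : m i ≠ p i + 1 := fun h1 => hmq <| by
      ext l
      rcases eq_or_ne l i with rfl | hl
      · simpa using h1
      · simpa [hl] using h l hl
    have h2 : m i ≤ p i - 1 ∨ p i + 2 ≤ m i := by omega
    simp only [PiLp.sub_apply, PiLp.add_apply, latticePoint_apply, PiLp.smul_apply,
      PiLp.single_apply, if_true, smul_eq_mul, mul_one]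
    rw [le_abs]
    rcases h2 with h2 | h2
    · right
      have h3 : (m i : ℝ) ≤ p i - 1 := by exact_mod_cast h2
      linarith
    · left
      have h3 : (p i : ℝ) + 2 ≤ m i := by exact_mod_cast h2
      linarith

lemma swap_add_single_mem_inducedPerms (hd : 2 ≤ d) (p : Fin d → ℤ) (i : Fin d) :
    Equiv.swap p (p + Pi.single i 1) ∈ inducedPerms d := by
  have : Nontrivial (Fin d) := Fin.nontrivial_iff_two_le.2 hd
  obtain ⟨j, hji⟩ := exists_ne i
  set u : EuclideanSpace ℝ (Fin d) := EuclideanSpace.single i 1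
  set c := latticePoint p + (1 / 2 : ℝ) • u with hc
  have hq : latticePoint (p + Pi.single i 1) = latticePoint p + u := by
    ext l
    rcases eq_or_ne l i with rfl | hl <;> simp [u, *]
  obtain ⟨f, hf, hsupp, h1, h2⟩ := exists_biLipschitz_twist (u := u)
    (v := EuclideanSpace.single j 1) (by simp [u]) (by simp)
    (by simp [u, EuclideanSpace.inner_single_left, hji.symm]) c
  have hcp : c - (1 / 2 : ℝ) • u = latticePoint p := by rw [hc]; module
  have hcq : c + (1 / 2 : ℝ) • u = latticePoint (p + Pi.single i 1) := by rw [hc, hq]; module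
  rw [hcp, hcq] at h1 h2
  refine ⟨f, hf, ⟨1 + ‖c‖, fun x hx => hsupp x ?_⟩, fun m => ?_⟩
  · rw [dist_eq_norm]
    linarith [norm_sub_norm_le x c]
  · rcases eq_or_ne m p with rfl | hmp
    · rw [h1, Equiv.swap_apply_left]
    rcases eq_or_ne m (p + Pi.single i 1) with rfl | hmq
    · rw [h2, Equiv.swap_apply_right]
    rw [Equiv.swap_apply_of_ne_of_ne hmp hmq]
    exact hsupp _ (one_le_dist_midpoint hmp hmq)

/-- In dimension at least two, every transposition of lattice points is induced by a compactly
supported bi-Lipschitz homeomorphism. -/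
lemma swap_mem_inducedPerms (hd : 2 ≤ d) (p q : Fin d → ℤ) :
    Equiv.swap p q ∈ inducedPerms d := by
  let A : AddSubgroup (Fin d → ℤ) :=
    { carrier := {v | ∀ p, Equiv.swap p (p + v) ∈ inducedPerms d}
      zero_mem' := fun p => by
        rw [add_zero, Equiv.swap_self]
        exact one_mem _
      add_mem' := fun {v w} hv hw p => by
        have h := hw (p + v)
        rw [add_assoc] at h
        exact SubmonoidClass.swap_mem_trans _ (hv p) h
      neg_mem' := fun {v} hv p => by
        have h := hv (p + -v)
        rwa [neg_add_cancel_right, Equiv.swap_comm] at h }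
  have hA : q - p ∈ A := by
    rw [pi_eq_sum_univ' (q - p)]
    refine A.sum_mem fun i _ => A.zsmul_mem ?_ _
    exact fun p => swap_add_single_mem_inducedPerms hd p i
  simpa using hA p

/-- Transpositions within a finite set of lattice points are induced by bi-Lipschitz
homeomorphisms with a common Lipschitz constant and a common support. -/
lemma exists_uniform_swaps (hd : 2 ≤ d) (S : Finset (Fin d → ℤ)) :
    ∃ (φ : (Fin d → ℤ) → (Fin d → ℤ) → Equiv.Perm (EuclideanSpace ℝ (Fin d))) (K : ℝ≥0) (ρ : ℝ),
      0 < ρ ∧ ∀ p ∈ S, ∀ q ∈ S, LipschitzWith K (φ p q) ∧ LipschitzWith K (φ p q).symm ∧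
        (∀ x, ρ ≤ ‖x‖ → φ p q x = x) ∧
        ∀ m, φ p q (latticePoint m) = latticePoint (Equiv.swap p q m) := by
  choose φ hφ hρ hswap using swap_mem_inducedPerms hd
  choose ρ hρ using hρ
  have hφ₁ : ∀ p q, ∃ K, LipschitzWith K (φ p q) := fun p q => (hφ p q).1
  have hφ₂ : ∀ p q, ∃ K, LipschitzWith K (φ p q).symm := fun p q => (hφ p q).2
  choose K hK using hφ₁
  choose K' hK' using hφ₂
  let C : ℝ≥0 := (S ×ˢ S).sup fun a => K a.1 a.2 + K' a.1 a.2
  let P : ℝ≥0 := (S ×ˢ S).sup fun a => (ρ a.1 a.2).toNNReal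
  refine ⟨φ, C, P + 1, by positivity, fun p hp q hq => ?_⟩
  have hmem : (p, q) ∈ S ×ˢ S := Finset.mk_mem_product hp hq
  have hC : K p q + K' p q ≤ C := Finset.le_sup (f := fun a : _ × _ => K a.1 a.2 + K' a.1 a.2) hmem
  have hP : (ρ p q).toNNReal ≤ P :=
    Finset.le_sup (f := fun a : _ × _ => (ρ a.1 a.2).toNNReal) hmem
  refine ⟨(hK p q).weaken (le_self_add.trans hC), (hK' p q).weaken (le_add_self.trans hC),
    fun x hx => hρ p q x ?_, hswap p q⟩
  have h1 : ((ρ p q).toNNReal : ℝ) ≤ P := hP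
  linarith [Real.le_coe_toNNReal (ρ p q)]

end Lattice

section Transport

variable {d : ℕ}

lemma le_dist_of_intCast_eq {m : ℕ} {N : ℤ} (hN : 1 ≤ N) {k l : Fin d → ℤ} (hkl : k ≠ l)
    (h : (fun i => (k i : ZMod m)) = fun i => (l i : ZMod m)) :
    (m : ℝ) ≤ dist (latticePoint (N • k)) (latticePoint (N • l)) := by
  obtain ⟨i, hi⟩ := Function.ne_iff.1 hkl
  have hdvd : (m : ℤ) ∣ k i - l i := by
    have h1 := congrFun h i
    exact (ZMod.intCast_eq_intCast_iff_dvd_sub _ _ _).1 h1.symm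
  have h2 : (m : ℤ) ≤ |k i - l i| :=
    Int.le_of_dvd (abs_pos.2 (sub_ne_zero.2 hi)) ((dvd_abs _ _).2 hdvd)
  have h3 : (m : ℤ) ≤ |N * k i - N * l i| := by
    rw [← mul_sub, abs_mul, abs_of_pos (by omega : 0 < N)]
    nlinarith [abs_nonneg (k i - l i)]
  rw [dist_eq_norm]
  refine le_trans ?_ (abs_apply_le_norm _ i)
  have h4 : (m : ℝ) ≤ |(N : ℝ) * k i - N * l i| := by exact_mod_cast h3
  simpa using h4

/-- The transpositions of `s k` and `t k`, where `k` ranges over a set of indices with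
well separated base points `N • k`, can be realized simultaneously. -/
lemma exists_biLipschitz_swaps {N : ℤ} {s t : (Fin d → ℤ) → Fin d → ℤ}
    (hs : Injective s) (ht : Injective t) (hst : ∀ k l, s k ≠ t l)
    {S : Finset (Fin d → ℤ)} (hsS : ∀ k, s k - N • k ∈ S) (htS : ∀ k, t k - N • k ∈ S)
    {φ : (Fin d → ℤ) → (Fin d → ℤ) → Equiv.Perm (EuclideanSpace ℝ (Fin d))} {K : ℝ≥0} {ρ : ℝ}
    (hρ : 0 < ρ) (hφ : ∀ p ∈ S, ∀ q ∈ S, LipschitzWith K (φ p q) ∧ LipschitzWith K (φ p q).symm ∧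
        (∀ x, ρ ≤ ‖x‖ → φ p q x = x) ∧
        ∀ m, φ p q (latticePoint m) = latticePoint (Equiv.swap p q m))
    {J : Set (Fin d → ℤ)} (hJ : ∀ k ∈ J, ∀ l ∈ J, k ≠ l →
      3 * ρ ≤ dist (latticePoint (N • k)) (latticePoint (N • l))) :
    ∃ F ∈ biLipschitzGroup (EuclideanSpace ℝ (Fin d)),
      (∀ k ∈ J, F (latticePoint (s k)) = latticePoint (t k)) ∧
      ∀ k ∉ J, F (latticePoint (s k)) = latticePoint (s k) ∧
        F (latticePoint (t k)) = latticePoint (t k) := by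
  let c : J → EuclideanSpace ℝ (Fin d) := fun k => latticePoint (N • k.1)
  let f : J → Equiv.Perm (EuclideanSpace ℝ (Fin d)) := fun k =>
    Equiv.addRight (c k) * φ (s k - N • k) (t k - N • k) * Equiv.addRight (-c k)
  have hf : ∀ k x, f k x = φ (s k - N • k) (t k - N • k) (x - c k) + c k := fun k x => by
    simp [f, sub_eq_add_neg]
  have hf' : ∀ k x, (f k).symm x = (φ (s k - N • k) (t k - N • k)).symm (x - c k) + c k :=
    fun k x => by
      rw [Equiv.symm_apply_eq, hf]
      simp
  have hfswap : ∀ k m, f k (latticePoint m) = latticePoint (Equiv.swap (s k) (t k) m) := by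
    intro k m
    rw [hf, ← latticePoint_sub, (hφ _ (hsS k) _ (htS k)).2.2.2, ← latticePoint_add]
    congr 1
    simp only [Equiv.swap_apply_def, sub_left_inj]
    split_ifs <;> simp
  obtain ⟨F, hF, hmove, hfix⟩ := exists_biLipschitz_glue (f := f) (c := c) hρ (K := K)
    (fun k l hkl => hJ k k.2 l l.2 (Subtype.coe_injective.ne hkl))
    (fun k x hx => by
      rw [hf, (hφ _ (hsS k) _ (htS k)).2.2.1 _ (by rwa [← dist_eq_norm]), sub_add_cancel])
    (fun k => LipschitzWith.of_dist_le_mul fun x y => by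
      rw [hf, hf, dist_add_right]
      simpa using (hφ _ (hsS k) _ (htS k)).1.dist_le_mul (x - c k) (y - c k))
    (fun k => LipschitzWith.of_dist_le_mul fun x y => by
      rw [hf', hf', dist_add_right]
      simpa using (hφ _ (hsS k) _ (htS k)).2.1.dist_le_mul (x - c k) (y - c k))
  refine ⟨F, hF, fun k hk => ?_, fun k hk => ⟨hfix _ fun l => ?_, hfix _ fun l => ?_⟩⟩
  · have h := hfswap ⟨k, hk⟩ (s k)
    rw [Equiv.swap_apply_left] at h
    rw [← h]
    refine hmove _ _ ?_
    rw [h]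
    exact latticePoint_injective.ne (hst k k).symm
  · have hkl : k ≠ l := fun h => hk (h ▸ l.2)
    rw [hfswap, Equiv.swap_apply_of_ne_of_ne (hs.ne hkl) (hst k l)]
  · have hkl : k ≠ l := fun h => hk (h ▸ l.2)
    rw [hfswap, Equiv.swap_apply_of_ne_of_ne (hst l k).symm (ht.ne hkl)]

/-- In dimension at least two, disjoint families of lattice points which are boundedly displaced
from `N • ℤ^d` are equivalent under a bi-Lipschitz homeomorphism. -/
lemma exists_biLipschitz_transport (hd : 2 ≤ d) {N : ℤ} (hN : 1 ≤ N) {B : ℤ}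
    {s t : (Fin d → ℤ) → Fin d → ℤ}
    (hs : Injective s) (ht : Injective t) (hst : ∀ k l, s k ≠ t l)
    (hsB : ∀ k i, |s k i - N * k i| ≤ B) (htB : ∀ k i, |t k i - N * k i| ≤ B) :
    ∃ F ∈ biLipschitzGroup (EuclideanSpace ℝ (Fin d)),
      ∀ k, F (latticePoint (s k)) = latticePoint (t k) := by
  classical
  let S : Finset (Fin d → ℤ) := Finset.Icc (fun _ => -B) fun _ => B
  have hsS : ∀ k, s k - N • k ∈ S := fun k =>
    Finset.mem_Icc.2 ⟨fun i => (abs_le.1 (hsB k i)).1, fun i => (abs_le.1 (hsB k i)).2⟩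
  have htS : ∀ k, t k - N • k ∈ S := fun k =>
    Finset.mem_Icc.2 ⟨fun i => (abs_le.1 (htB k i)).1, fun i => (abs_le.1 (htB k i)).2⟩
  obtain ⟨φ, K, ρ, hρ, hφ⟩ := exists_uniform_swaps hd S
  obtain ⟨m, hm⟩ := exists_nat_ge (3 * ρ)
  have hm0 : NeZero m := ⟨by
    rintro rfl
    push_cast at hm
    linarith⟩
  let color : (Fin d → ℤ) → Fin d → ZMod m := fun k i => k i
  have key : ∀ A : Finset (Fin d → ZMod m), ∃ F ∈ biLipschitzGroup (EuclideanSpace ℝ (Fin d)),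
      ∀ k, F (latticePoint (s k)) = latticePoint (if color k ∈ A then t k else s k) := by
    intro A
    induction A using Finset.induction_on with
    | empty => exact ⟨1, one_mem _, fun k => by simp⟩
    | insert a A ha ih =>
      obtain ⟨F, hF, hFs⟩ := ih
      obtain ⟨G, hG, hGmove, hGfix⟩ := exists_biLipschitz_swaps hs ht hst hsS htS hρ hφ
        (J := {k | color k = a})
        fun k hk l hl hkl => hm.trans (le_dist_of_intCast_eq hN hkl (hk.trans hl.symm))
      refine ⟨G * F, mul_mem hG hF, fun k => ?_⟩
      rw [Equiv.Perm.mul_apply, hFs]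
      by_cases hk : color k = a
      · simp [hk, ha, hGmove k hk]
      · by_cases hkA : color k ∈ A
        · simp [hkA, (hGfix k hk).2]
        · simp [hk, hkA, (hGfix k hk).1]
  obtain ⟨F, hF, h⟩ := key Finset.univ
  exact ⟨F, hF, fun k => by simpa using h k⟩

lemma norm_le_of_forall_abs_le {x : EuclideanSpace ℝ (Fin d)} {a : ℝ}
    (h : ∀ i, |x i| ≤ a) : ‖x‖ ≤ d * a := by
  have h1 : x = ∑ i, EuclideanSpace.single i (x i) := by
    ext j
    simp
  calc ‖x‖ = ‖∑ i, EuclideanSpace.single i (x i)‖ := by rw [← h1]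
    _ ≤ ∑ i, ‖EuclideanSpace.single i (x i)‖ := norm_sum_le _ _
    _ ≤ ∑ _i : Fin d, a := Finset.sum_le_sum fun i _ => by simpa using h i
    _ = d * a := by simp

lemma exists_biLipschitz_smul {E : Type*} [NormedAddCommGroup E] [NormedSpace ℝ E] {a : ℝ}
    (ha : a ≠ 0) : ∃ f ∈ biLipschitzGroup E, ∀ x, f x = a • x :=
  ⟨(Homeomorph.smulOfNeZero a ha).toEquiv,
    ⟨⟨_, lipschitzWith_smul a⟩, ⟨_, lipschitzWith_smul a⁻¹⟩⟩, fun _ => rfl⟩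

lemma exists_biLipschitz_rectifying_of_two_le (hd : 2 ≤ d) {r : ℝ} (hr : 0 < r)
    {x : (Fin d → ℤ) → EuclideanSpace ℝ (Fin d)}
    (hx : ∀ k l, k ≠ l → r ≤ dist (x k) (x l)) {M : ℝ}
    (hM : ∀ k, ‖x k - latticePoint k‖ ≤ M) :
    ∃ F ∈ biLipschitzGroup (EuclideanSpace ℝ (Fin d)), ∀ k, F (x k) = latticePoint k := by
  have hxinj : Injective x := fun k l h => by
    by_contra hkl
    have := hx k l hkl
    rw [h, dist_self] at this
    linarith
  obtain ⟨η, hη, hdisp⟩ := exists_biLipschitz_displacing (S := range x) hr (by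
    rintro _ ⟨k, rfl⟩ _ ⟨l, rfl⟩ hkl
    exact hx k l fun h => hkl (by rw [h]))
  obtain ⟨n, hn⟩ := exists_nat_gt (d / η)
  have hn0 : (0 : ℝ) < n := lt_of_le_of_lt (by positivity) hn
  have hn1 : 1 ≤ n := by exact_mod_cast hn0
  have hnη : d * (1 / (n : ℝ)) ≤ η := by
    rw [div_lt_iff₀ hη] at hn
    rw [mul_one_div, div_le_iff₀ hn0]
    linarith
  let s : (Fin d → ℤ) → Fin d → ℤ := fun k i => 2 * round (n * x k i)
  let i₀ : Fin d := ⟨0, by omega⟩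
  let e : Fin d → ℤ := Pi.single i₀ 1
  let t : (Fin d → ℤ) → Fin d → ℤ := fun k => (2 * (n : ℤ)) • k + e
  have hround : ∀ k i, |(s k i : ℝ) - 2 * n * x k i| ≤ 1 := fun k i => by
    have h := abs_le.1 (abs_sub_round ((n : ℝ) * x k i))
    simp only [s]
    push_cast
    rw [abs_le]
    constructor <;> linarith
  have ha : (2 * (n : ℝ))⁻¹ ≠ 0 := by positivity
  obtain ⟨f, hf, hfx⟩ := hdisp (fun y => WithLp.toLp 2 fun i =>
    (2 * (n : ℝ))⁻¹ * (2 * round (n * y i) : ℤ) - y i) (by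
      rintro _ ⟨k, rfl⟩
      refine (norm_le_of_forall_abs_le fun i => ?_).trans hnη
      have h1 : (2 * (n : ℝ))⁻¹ * (s k i : ℝ) - x k i =
          (2 * (n : ℝ))⁻¹ * ((s k i : ℝ) - 2 * n * x k i) := by field_simp
      change |(2 * (n : ℝ))⁻¹ * (s k i : ℝ) - x k i| ≤ _
      rw [h1, abs_mul, abs_of_pos (by positivity)]
      have h2 : (2 * (n : ℝ))⁻¹ ≤ 1 / n := by
        rw [← one_div]
        exact one_div_le_one_div_of_le hn0 (by linarith)
      calc _ ≤ 1 / (n : ℝ) * 1 := by gcongr; exact hround k i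
        _ = _ := mul_one _)
  have hfs : ∀ k, f (x k) = (2 * (n : ℝ))⁻¹ • latticePoint (s k) := fun k => by
    rw [hfx _ (mem_range_self k)]
    ext i
    simp [s]
  have hs : Injective s := fun k l h => by
    apply hxinj
    apply f.injective
    rw [hfs, hfs, h]
  have ht : Injective t := fun k l h => by
    have h1 := add_right_cancel h
    exact smul_right_injective _ (by omega : 2 * (n : ℤ) ≠ 0) h1
  have hst : ∀ k l, s k ≠ t l := fun k l h => by
    have h1 := congrFun h i₀
    simp only [s, t, e, Pi.add_apply, Pi.smul_apply, Pi.single_eq_same, smul_eq_mul,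
      mul_assoc] at h1
    omega
  have hsB : ∀ k i, |s k i - 2 * n * k i| ≤ ⌈2 * n * M + 1⌉ := fun k i => by
    have h1 : |x k i - k i| ≤ M := (abs_apply_le_norm _ i).trans (hM k)
    have h2 : |(s k i : ℝ) - 2 * n * k i| ≤ 2 * n * M + 1 := by
      have h3 : (s k i : ℝ) - 2 * n * k i =
        ((s k i : ℝ) - 2 * n * x k i) + 2 * n * (x k i - k i) := by ring
      rw [h3]
      refine (abs_add_le _ _).trans ?_
      rw [abs_mul, abs_of_pos (by positivity : (0 : ℝ) < 2 * n)]
      nlinarith [hround k i]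
    have h3 := h2.trans (Int.le_ceil _)
    exact_mod_cast h3
  have hM0 : 0 ≤ M := (norm_nonneg _).trans (hM 0)
  have htB : ∀ k i, |t k i - 2 * n * k i| ≤ ⌈2 * n * M + 1⌉ := fun k i => by
    have h1 : |t k i - 2 * n * k i| ≤ 1 := by
      rcases eq_or_ne i i₀ with rfl | hi <;> simp [t, e, *]
    refine h1.trans (Int.one_le_ceil_iff.2 ?_)
    positivity
  obtain ⟨F, hF, hFs⟩ := exists_biLipschitz_transport hd (by omega) hs ht hst hsB htB
  obtain ⟨g, hg, hgx⟩ := exists_biLipschitz_smul (E := EuclideanSpace ℝ (Fin d)) ha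
  refine ⟨g * (Equiv.addRight (-latticePoint e) * (F * (g⁻¹ * f))), mul_mem hg
    (mul_mem (addRight_mem_biLipschitzGroup _) (mul_mem hF (mul_mem (inv_mem hg) hf))), fun k => ?_⟩
  have h1 : (g⁻¹ * f) (x k) = latticePoint (s k) := by
    rw [Equiv.Perm.mul_apply, Equiv.Perm.inv_eq_iff_eq, hgx, hfs]
  have h2 : Equiv.addRight (-latticePoint e) (latticePoint (t k)) =
      latticePoint ((2 * (n : ℤ)) • k) := by
    change latticePoint (t k) + -latticePoint e = _
    rw [← sub_eq_add_neg, ← latticePoint_sub, add_sub_cancel_right]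
  rw [Equiv.Perm.mul_apply, Equiv.Perm.mul_apply, Equiv.Perm.mul_apply, h1, hFs, h2, hgx]
  ext i
  have : (n : ℝ) ≠ 0 := hn0.ne'
  simp
  field_simp

end Transport

section Line

lemma finite_inter_Icc_of_separated {S : Set ℝ} {r : ℝ} (hr : 0 < r)
    (hS : ∀ x ∈ S, ∀ y ∈ S, x ≠ y → r ≤ dist x y) (a b : ℝ) : (S ∩ Icc a b).Finite := by
  refine Set.Finite.of_injOn (f := fun x => ⌊x / r⌋) (t := Icc ⌊a / r⌋ ⌊b / r⌋) ?_ ?_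
    (finite_Icc _ _)
  · rintro x ⟨_, hax, hxb⟩
    exact ⟨Int.floor_le_floor (by gcongr), Int.floor_le_floor (by gcongr)⟩
  · rintro x ⟨hx, _⟩ y ⟨hy, _⟩ hxy
    by_contra hne
    have h1 := Int.abs_sub_lt_one_of_floor_eq_floor hxy
    rw [← sub_div, abs_div, abs_of_pos hr, div_lt_one hr, ← Real.dist_eq] at h1
    linarith [hS x hx y hy hne]

/-- A Delone set on the line is order isomorphic to the integers. -/
lemma nonempty_orderIso_int {S : Set ℝ} {r R : ℝ} (hr : 0 < r)
    (hS : ∀ x ∈ S, ∀ y ∈ S, x ≠ y → r ≤ dist x y) (hR : ∀ x : ℝ, ∃ y ∈ S, dist x y ≤ R) :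
    Nonempty (S ≃o ℤ) := by
  classical
  have hIcc : ∀ a b : S, (Icc a b).Finite := fun a b => by
    refine Set.Finite.of_injOn (f := Subtype.val) (t := S ∩ Icc a b) ?_
      Subtype.coe_injective.injOn (finite_inter_Icc_of_separated hr hS a b)
    rintro ⟨x, hx⟩ ⟨h1, h2⟩
    exact ⟨hx, h1, h2⟩
  let _ : LocallyFiniteOrder S := LocallyFiniteOrder.ofFiniteIcc hIcc
  let _ : SuccOrder S := LinearLocallyFiniteOrder.succOrder S
  let _ : PredOrder S := LinearLocallyFiniteOrder.predOrder S
  have : NoMaxOrder S := ⟨fun a => by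
    obtain ⟨y, hy, h⟩ := hR (a + R + 1)
    refine ⟨⟨y, hy⟩, Subtype.coe_lt_coe.1 ?_⟩
    change (a : ℝ) < y
    linarith [(abs_le.1 (Real.dist_eq _ _ ▸ h)).2]⟩
  have : NoMinOrder S := ⟨fun a => by
    obtain ⟨y, hy, h⟩ := hR (a - R - 1)
    refine ⟨⟨y, hy⟩, Subtype.coe_lt_coe.1 ?_⟩
    change y < (a : ℝ)
    linarith [(abs_le.1 (Real.dist_eq _ _ ▸ h)).1]⟩
  have : Nonempty S := by
    obtain ⟨y, hy, _⟩ := hR 0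
    exact ⟨⟨y, hy⟩⟩
  exact ⟨orderIsoIntOfLinearSuccPredArch⟩

/-- A sequence indexed by the integers whose increments lie in a compact interval of positive
numbers is the image of the integers under a bi-Lipschitz homeomorphism of the line. -/
lemma exists_biLipschitz_interpolating {a : ℤ → ℝ} {r R : ℝ} (hr : 0 < r)
    (h1 : ∀ n, r ≤ a (n + 1) - a n) (h2 : ∀ n, a (n + 1) - a n ≤ R) :
    ∃ f ∈ biLipschitzGroup ℝ, ∀ n : ℤ, f n = a n := by
  have hrR : r ≤ R := (h1 0).trans (h2 0)
  have key : ∀ n m : ℤ, n ≤ m → r * (m - n : ℝ) ≤ a m - a n ∧ a m - a n ≤ R * (m - n : ℝ) := by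
    intro n m hnm
    induction m, hnm using Int.leInduction with
    | base => simp
    | succ m _ ih =>
      push_cast
      constructor <;> linarith [h1 m, h2 m]
  set c := (R + r) / 2 with hc
  have hc0 : 0 < c := by linarith
  let κ : ℝ≥0 := ⟨(R - r) / 2 / c, div_nonneg (by linarith) hc0.le⟩
  have hκ : κ < 1 := by
    refine NNReal.coe_lt_coe.1 ?_
    change (R - r) / 2 / c < 1
    rw [div_lt_one hc0]
    linarith
  have hdist : ∀ n m : ℤ, n ≤ m → dist (c⁻¹ * a n - n) (c⁻¹ * a m - m) ≤ κ * dist (n : ℝ) m := by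
    intro n m hnm
    have hnm' : (n : ℝ) ≤ m := by exact_mod_cast hnm
    have h3 : c⁻¹ * a n - n - (c⁻¹ * a m - m) = c⁻¹ * (c * (m - n) - (a m - a n)) := by
      field_simp
      ring
    have h4 : |c * (m - n : ℝ) - (a m - a n)| ≤ (R - r) / 2 * (m - n) := by
      rw [abs_le, hc]
      constructor <;> linarith [key n m hnm]
    rw [Real.dist_eq, h3, dist_comm, Real.dist_eq, abs_mul, abs_of_pos (inv_pos.2 hc0),
      abs_of_nonneg (sub_nonneg.2 hnm')]
    change _ ≤ (R - r) / 2 / c * _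
    calc _ ≤ c⁻¹ * ((R - r) / 2 * (m - n)) := by gcongr
      _ = _ := by ring
  have hlip : LipschitzOnWith κ (fun x : ℝ => c⁻¹ * a ⌊x⌋ - x) (range ((↑) : ℤ → ℝ)) := by
    refine LipschitzOnWith.of_dist_le_mul ?_
    rintro _ ⟨n, rfl⟩ _ ⟨m, rfl⟩
    simp only [Int.floor_intCast]
    rcases le_total n m with h | h
    · exact hdist n m h
    · rw [dist_comm, dist_comm (n : ℝ)]
      exact hdist m n h
  obtain ⟨g, hg, hga⟩ := hlip.extend_real
  obtain ⟨f, hf, hfg⟩ := exists_biLipschitz_add_contracting hκ hg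
  obtain ⟨φ, hφ, hφc⟩ := exists_biLipschitz_smul (E := ℝ) hc0.ne'
  refine ⟨φ * f, mul_mem hφ hf, fun n => ?_⟩
  rw [Equiv.Perm.mul_apply, hφc, hfg, ← hga (mem_range_self n)]
  simp only [Int.floor_intCast, smul_eq_mul]
  field_simp
  ring

lemma exists_biLipschitz_rectifying_real {S : Set ℝ} {r R : ℝ} (hr : 0 < r)
    (hS : ∀ x ∈ S, ∀ y ∈ S, x ≠ y → r ≤ dist x y) (hR : ∀ x : ℝ, ∃ y ∈ S, dist x y ≤ R) :
    ∃ f ∈ biLipschitzGroup ℝ, f '' S = range ((↑) : ℤ → ℝ) := by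
  obtain ⟨e⟩ := nonempty_orderIso_int hr hS hR
  let a : ℤ → ℝ := fun n => e.symm n
  have hmono : StrictMono a := fun n m h => e.symm.strictMono h
  have hrange : range a = S := by
    ext x
    constructor
    · rintro ⟨n, rfl⟩
      exact (e.symm n).2
    · exact fun hx => ⟨e ⟨x, hx⟩, by simp [a]⟩
  have hlt : ∀ n, a n < a (n + 1) := fun n => hmono (lt_add_one n)
  obtain ⟨f, hf, hfa⟩ := exists_biLipschitz_interpolating (a := a) (R := 2 * R) hr
    (fun n => by
      have h := hS _ (e.symm (n + 1)).2 _ (e.symm n).2 (hlt n).ne'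
      rwa [Real.dist_eq, abs_of_pos (sub_pos.2 (hlt n))] at h)
    (fun n => by
      obtain ⟨y, hy, h⟩ := hR ((a n + a (n + 1)) / 2)
      rw [← hrange] at hy
      obtain ⟨m, rfl⟩ := hy
      rw [Real.dist_eq, abs_le] at h
      rcases le_or_gt m n with hm | hm
      · linarith [hmono.monotone hm]
      · linarith [hmono.monotone (Int.add_one_le_of_lt hm)])
  refine ⟨f⁻¹, inv_mem hf, ?_⟩
  rw [← hrange, ← range_comp]
  congr 1
  ext n
  rw [comp_apply, Equiv.Perm.inv_eq_iff_eq, hfa]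

/-- The line, as a one-dimensional Euclidean space. -/
noncomputable def euclideanLineIsometry : EuclideanSpace ℝ (Fin 1) ≃ᵢ ℝ :=
  IsometryEquiv.mk' (fun x => x 0) (fun t => WithLp.toLp 2 fun _ => t) (fun _ => rfl) <|
    Isometry.of_dist_eq fun x y => by
      simp [EuclideanSpace.dist_eq, Real.dist_eq, Real.sqrt_sq_eq_abs]

lemma exists_biLipschitz_rectifying_dim_one {D : Set (EuclideanSpace ℝ (Fin 1))} {r R : ℝ}
    (hr : 0 < r) (hD : ∀ x ∈ D, ∀ y ∈ D, x ≠ y → r ≤ dist x y)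
    (hR : ∀ x : EuclideanSpace ℝ (Fin 1), ∃ y ∈ D, dist x y ≤ R) :
    ∃ f ∈ biLipschitzGroup (EuclideanSpace ℝ (Fin 1)), f '' D = intLattice 1 := by
  let φ := euclideanLineIsometry
  obtain ⟨f, ⟨⟨K, hK⟩, K', hK'⟩, hfD⟩ := exists_biLipschitz_rectifying_real (S := φ '' D) (R := R)
    hr (by
      rintro _ ⟨x, hx, rfl⟩ _ ⟨y, hy, rfl⟩ hxy
      rw [φ.dist_eq]
      exact hD x hx y hy fun h => hxy (by rw [h]))
    (fun t => by
      obtain ⟨y, hy, h⟩ := hR (φ.symm t)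
      refine ⟨φ y, mem_image_of_mem _ hy, ?_⟩
      rwa [← φ.apply_symm_apply t, φ.dist_eq])
  refine ⟨(φ.toEquiv.trans f).trans φ.symm.toEquiv,
    ⟨⟨_, φ.symm.isometry.lipschitz.comp (hK.comp φ.isometry.lipschitz)⟩,
      ⟨_, φ.symm.isometry.lipschitz.comp (hK'.comp φ.isometry.lipschitz)⟩⟩, ?_⟩
  have h1 : ((φ.toEquiv.trans f).trans φ.symm.toEquiv : _ → _) '' D = φ.symm '' (f '' (φ '' D)) := by
    rw [image_image, image_image]
    rfl
  rw [h1, hfD]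
  ext x
  rw [IsometryEquiv.image_symm]
  constructor
  · rintro ⟨n, hn⟩ i
    rw [Subsingleton.elim i 0]
    exact ⟨n, hn.symm⟩
  · intro h
    obtain ⟨n, hn⟩ := h 0
    exact ⟨n, hn.symm⟩

end Line

lemma exists_biLipschitz_bounds {E : Type*} [NormedAddCommGroup E] {f : Equiv.Perm E}
    (hf : f ∈ biLipschitzGroup E) : ∃ K : ℝ, 1 ≤ K ∧ ∀ u v : E,
      (1 / K) * ‖u - v‖ ≤ ‖f u - f v‖ ∧ ‖f u - f v‖ ≤ K * ‖u - v‖ := by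
  obtain ⟨⟨K, hK⟩, K', hK'⟩ := hf
  have hK0 := K.coe_nonneg
  have hK'0 := K'.coe_nonneg
  refine ⟨1 + K + K', by linarith, fun u v => ⟨?_, ?_⟩⟩
  · have h := hK'.dist_le_mul (f u) (f v)
    rw [Equiv.symm_apply_apply, Equiv.symm_apply_apply, dist_eq_norm, dist_eq_norm] at h
    rw [one_div, inv_mul_le_iff₀ (by positivity)]
    nlinarith [norm_nonneg (f u - f v)]
  · have h := hK.dist_le_mul u v
    rw [dist_eq_norm, dist_eq_norm] at h
    nlinarith [norm_nonneg (u - v)]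

/-- **Lemma.** If a Delone set D' in ℝ^d is a boundedly displaced image of ℤ^d, then there
is a bi-Lipschitz homeomorphism F of ℝ^d with F(D') = ℤ^d. -/
theorem boundedly_displaced_delone_rectifiable_by_ambient_biLipschitz
    (d : ℕ) (hd : 1 ≤ d) (D' : Set (EuclideanSpace ℝ (Fin d)))
    -- D' is a Delone set:
    (r R : ℝ) (hr : 0 < r) (hR : 0 < R)
    (hUnifDisc : ∀ x ∈ D', ∀ y ∈ D', x ≠ y → r ≤ dist x y)
    (hRelDense : ∀ x : EuclideanSpace ℝ (Fin d), ∃ y ∈ D', dist x y ≤ R)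
    -- D' is a boundedly displaced image of ℤ^d:
    (Ψ : intLattice d → D') (hΨbij : Function.Bijective Ψ)
    (M : ℝ) (hΨdisp : ∀ z : intLattice d, ‖(Ψ z : EuclideanSpace ℝ (Fin d)) - (z : EuclideanSpace ℝ (Fin d))‖ ≤ M) :
    -- conclusion: a bi-Lipschitz homeomorphism F of ℝ^d with F(D') = ℤ^d
    ∃ F : EuclideanSpace ℝ (Fin d) → EuclideanSpace ℝ (Fin d),
      Function.Bijective F ∧
      (∃ K : ℝ, 1 ≤ K ∧ ∀ u v : EuclideanSpace ℝ (Fin d),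
        (1 / K) * ‖u - v‖ ≤ ‖F u - F v‖ ∧ ‖F u - F v‖ ≤ K * ‖u - v‖) ∧
      F '' D' = intLattice d := by
  suffices h : ∃ f ∈ biLipschitzGroup (EuclideanSpace ℝ (Fin d)), f '' D' = intLattice d by
    obtain ⟨f, hf, hfD⟩ := h
    exact ⟨f, f.bijective, exists_biLipschitz_bounds hf, hfD⟩
  rcases hd.eq_or_lt with rfl | hd2
  · exact exists_biLipschitz_rectifying_dim_one hr hUnifDisc hRelDense
  · let p : (Fin d → ℤ) → intLattice d := fun k => ⟨latticePoint k, fun i => ⟨k i, rfl⟩⟩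
    have hp : Injective p := fun k l h => latticePoint_injective (congrArg Subtype.val h)
    have hp' : Surjective p := by
      rintro ⟨z, hz⟩
      obtain ⟨k, rfl⟩ := intLattice_eq_range ▸ hz
      exact ⟨k, rfl⟩
    obtain ⟨F, hF, hFx⟩ := exists_biLipschitz_rectifying_of_two_le hd2 hr
      (x := fun k => (Ψ (p k) : EuclideanSpace ℝ (Fin d)))
      (fun k l hkl => hUnifDisc _ (Ψ (p k)).2 _ (Ψ (p l)).2
        (Subtype.coe_injective.ne (hΨbij.1.ne (hp.ne hkl))))
      (fun k => hΨdisp (p k))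
    refine ⟨F, hF, ?_⟩
    have hD : D' = range fun k => (Ψ (p k) : EuclideanSpace ℝ (Fin d)) := by
      have h := (hΨbij.2.comp hp').range_eq
      calc D' = Subtype.val '' (univ : Set D') := by simp
        _ = _ := by rw [← h, ← range_comp]; rfl
    rw [hD, ← range_comp, intLattice_eq_range]
    congr 1
    ext1 k
    exact hFx k
end

section
/- Let D be a Delone set in ℝ. Then there exists a bi-Lipschitz homeomorphism F : ℝ → ℝ such that F(D) = ℤ. -/
/-- The piecewise linear interpolation of a sequence indexed by `ℤ`. -/
noncomputable def linInterp (a : ℤ → ℝ) (t : ℝ) : ℝ :=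
  a ⌊t⌋ + Int.fract t * (a (⌊t⌋ + 1) - a ⌊t⌋)

lemma linInterp_intCast (a : ℤ → ℝ) (n : ℤ) : linInterp a n = a n := by
  simp [linInterp]

lemma monotone_linInterp {a : ℤ → ℝ} (ha : Monotone a) : Monotone (linInterp a) := by
  intro s t hst
  have step (u : ℝ) : 0 ≤ a (⌊u⌋ + 1) - a ⌊u⌋ := sub_nonneg.2 (ha (by lia))
  rcases (Int.floor_mono hst).eq_or_lt with h | h
  · have hf : Int.fract s ≤ Int.fract t := by
      simp only [Int.fract, h]
      linarith
    have := mul_le_mul_of_nonneg_right hf (step t)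
    simp only [linInterp, h]
    linarith
  · have h1 : linInterp a s ≤ a (⌊s⌋ + 1) := by
      have := mul_le_mul_of_nonneg_right (Int.fract_lt_one s).le (step s)
      simp only [linInterp]
      linarith
    have h2 : a ⌊t⌋ ≤ linInterp a t :=
      le_add_of_nonneg_right (mul_nonneg (Int.fract_nonneg t) (step t))
    exact h1.trans ((ha (by lia)).trans h2)

lemma mul_sub_le_linInterp_sub {a : ℤ → ℝ} {c : ℝ} (ha : ∀ n, c ≤ a (n + 1) - a n)
    {s t : ℝ} (hst : s ≤ t) : c * (t - s) ≤ linInterp a t - linInterp a s := by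
  have hmono : Monotone fun n : ℤ => a n - c * n := by
    refine monotone_int_of_le_succ fun n => ?_
    have := ha n
    push_cast
    linarith
  have key (u : ℝ) : linInterp (fun n : ℤ => a n - c * n) u = linInterp a u - c * u := by
    simp only [linInterp]
    push_cast
    linear_combination (-c) * Int.floor_add_fract u
  have := monotone_linInterp hmono hst
  rw [key, key] at this
  linarith

lemma linInterp_sub_le_mul_sub {a : ℤ → ℝ} {C : ℝ} (ha : ∀ n, a (n + 1) - a n ≤ C)
    {s t : ℝ} (hst : s ≤ t) : linInterp a t - linInterp a s ≤ C * (t - s) := by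
  have hneg (u : ℝ) : linInterp (fun n => -a n) u = -linInterp a u := by
    simp only [linInterp]
    ring
  have := mul_sub_le_linInterp_sub (a := fun n => -a n) (c := -C)
    (fun n => by linarith [ha n]) hst
  rw [hneg, hneg] at this
  linarith

lemma abs_linInterp_sub_bounds {a : ℤ → ℝ} {c C : ℝ} (hc : 0 < c)
    (hac : ∀ n, c ≤ a (n + 1) - a n) (haC : ∀ n, a (n + 1) - a n ≤ C) (s t : ℝ) :
    c * |s - t| ≤ |linInterp a s - linInterp a t| ∧
      |linInterp a s - linInterp a t| ≤ C * |s - t| := by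
  wlog hst : s ≤ t generalizing s t
  · rw [abs_sub_comm s, abs_sub_comm (linInterp a s)]
    exact this t s (le_of_not_ge hst)
  have h1 := mul_sub_le_linInterp_sub hac hst
  have h2 := linInterp_sub_le_mul_sub haC hst
  have h3 : 0 ≤ c * (t - s) := mul_nonneg hc.le (sub_nonneg.2 hst)
  rw [abs_sub_comm s, abs_sub_comm (linInterp a s), abs_of_nonneg (sub_nonneg.2 hst),
    abs_of_nonneg (h3.trans h1)]
  exact ⟨h1, h2⟩

lemma bijective_linInterp {a : ℤ → ℝ} {c C : ℝ} (hc : 0 < c)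
    (hac : ∀ n, c ≤ a (n + 1) - a n) (haC : ∀ n, a (n + 1) - a n ≤ C) :
    Function.Bijective (linInterp a) := by
  have hC : 0 ≤ C := hc.le.trans ((hac 0).trans (haC 0))
  constructor
  · intro s t hst
    have := (abs_linInterp_sub_bounds hc hac haC s t).1
    rw [hst, sub_self, abs_zero] at this
    have h0 : |s - t| ≤ 0 := nonpos_of_mul_nonpos_right this hc
    exact sub_eq_zero.1 (abs_nonpos_iff.1 h0)
  · have hcont : Continuous (linInterp a) :=
      (LipschitzWith.of_dist_le_mul (K := ⟨C, hC⟩) fun s t =>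
        (abs_linInterp_sub_bounds hc hac haC s t).2).continuous
    intro y
    have hy : 0 ≤ |y - linInterp a 0| / c := by positivity
    have hcy : c * (|y - linInterp a 0| / c) = |y - linInterp a 0| := by field_simp
    have h1 := mul_sub_le_linInterp_sub hac hy
    have h2 := mul_sub_le_linInterp_sub hac (neg_nonpos.2 hy)
    refine mem_range_of_exists_le_of_exists_ge hcont ⟨-(|y - linInterp a 0| / c), ?_⟩
      ⟨|y - linInterp a 0| / c, ?_⟩
    · linarith [neg_abs_le (y - linInterp a 0)]
    · linarith [le_abs_self (y - linInterp a 0)]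

lemma finite_inter_Icc_of_uniformlyDiscrete {D : Set ℝ} {r : ℝ} (hr : 0 < r)
    (hD : ∀ x ∈ D, ∀ y ∈ D, x ≠ y → r ≤ dist x y) (u v : ℝ) : (D ∩ Set.Icc u v).Finite := by
  refine Set.Finite.of_injOn (f := fun x => ⌊x / r⌋) (t := Set.Icc ⌊u / r⌋ ⌊v / r⌋) ?_ ?_
    (Set.finite_Icc _ _)
  · rintro x ⟨-, hux, hxv⟩
    exact ⟨Int.floor_mono (by gcongr), Int.floor_mono (by gcongr)⟩
  · rintro x ⟨hx, -⟩ y ⟨hy, -⟩ hxy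
    by_contra hne
    have h := Int.abs_sub_lt_one_of_floor_eq_floor hxy
    rw [← sub_div, abs_div, abs_of_pos hr, div_lt_one hr] at h
    exact absurd (hD x hx y hy hne) (not_le.2 h)

/-- A Delone set in `ℝ` is order isomorphic to `ℤ`. -/
lemma nonempty_int_orderIso_of_delone {D : Set ℝ} {r R : ℝ} (hr : 0 < r)
    (hD : ∀ x ∈ D, ∀ y ∈ D, x ≠ y → r ≤ dist x y)
    (hR : ∀ x : ℝ, ∃ y ∈ D, dist x y ≤ R) : Nonempty (ℤ ≃o D) := by
  classical
  have : Nonempty D := let ⟨y, hy, _⟩ := hR 0; ⟨⟨y, hy⟩⟩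
  have : NoMaxOrder D := ⟨fun x => by
    obtain ⟨y, hy, h⟩ := hR (x + R + 1)
    rw [Real.dist_eq, abs_le] at h
    exact ⟨⟨y, hy⟩, Subtype.coe_lt_coe.1 (by dsimp only; linarith)⟩⟩
  have : NoMinOrder D := ⟨fun x => by
    obtain ⟨y, hy, h⟩ := hR (x - R - 1)
    rw [Real.dist_eq, abs_le] at h
    exact ⟨⟨y, hy⟩, Subtype.coe_lt_coe.1 (by dsimp only; linarith)⟩⟩
  let _ : LocallyFiniteOrder D := LocallyFiniteOrder.ofFiniteIcc fun x y =>
    Set.Finite.of_injOn (f := Subtype.val) (t := D ∩ Set.Icc x y)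
      (fun z hz => ⟨z.2, hz.1, hz.2⟩)
      Subtype.val_injective.injOn (finite_inter_Icc_of_uniformlyDiscrete hr hD x y)
  let _ : SuccOrder D := LinearLocallyFiniteOrder.succOrder D
  let _ : PredOrder D := LinearLocallyFiniteOrder.predOrder D
  exact ⟨orderIsoIntOfLinearSuccPredArch.symm⟩

lemma sub_le_two_mul_of_relativelyDense {D : Set ℝ} {R : ℝ}
    (hR : ∀ x : ℝ, ∃ y ∈ D, dist x y ≤ R) (e : ℤ ≃o D) (n : ℤ) :
    (e (n + 1) : ℝ) - e n ≤ 2 * R := by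
  obtain ⟨y, hy, h⟩ := hR (((e n : ℝ) + e (n + 1)) / 2)
  obtain ⟨k, hk⟩ := e.surjective ⟨y, hy⟩
  have hky : (e k : ℝ) = y := by rw [hk]
  rw [Real.dist_eq, abs_le, ← hky] at h
  rcases le_or_gt k n with hkn | hkn
  · have : (e k : ℝ) ≤ e n := e.monotone hkn
    linarith
  · have : (e (n + 1) : ℝ) ≤ e k := e.monotone (Int.add_one_le_of_lt hkn)
    linarith

/-- Every Delone set in ℝ can be mapped onto ℤ by a bi-Lipschitz homeomorphism of ℝ. -/
theorem delone_dim_one_rectifiable_by_ambient_biLipschitz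
    (D : Set ℝ)
    -- D is a Delone set:
    (r R : ℝ) (hr : 0 < r) (hR : 0 < R)
    (hUnifDisc : ∀ x ∈ D, ∀ y ∈ D, x ≠ y → r ≤ dist x y)
    (hRelDense : ∀ x : ℝ, ∃ y ∈ D, dist x y ≤ R) :
    -- conclusion: a bi-Lipschitz homeomorphism F of ℝ with F(D) = ℤ
    ∃ F : ℝ → ℝ,
      Function.Bijective F ∧
      (∃ K : ℝ, 1 ≤ K ∧ ∀ u v : ℝ,
        (1 / K) * |u - v| ≤ |F u - F v| ∧ |F u - F v| ≤ K * |u - v|) ∧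
      F '' D = {x : ℝ | ∃ n : ℤ, x = (n : ℝ)} := by
  obtain ⟨e⟩ := nonempty_int_orderIso_of_delone hr hUnifDisc hRelDense
  set a : ℤ → ℝ := fun n => e n with ha
  have hlow (n : ℤ) : r ≤ a (n + 1) - a n := by
    have hlt : a n < a (n + 1) := e.strictMono (lt_add_one n)
    have := hUnifDisc _ (e (n + 1)).2 _ (e n).2 hlt.ne'
    rwa [Real.dist_eq, abs_of_pos (sub_pos.2 hlt)] at this
  have hup : ∀ n, a (n + 1) - a n ≤ 2 * R := sub_le_two_mul_of_relativelyDense hRelDense e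
  let G : ℝ ≃ ℝ := Equiv.ofBijective _ (bijective_linInterp hr hlow hup)
  have hG (n : ℤ) : G n = e n := linInterp_intCast a n
  refine ⟨G.symm, G.symm.bijective, ⟨max 1 (max (2 * R) (1 / r)), le_max_left _ _,
    fun u v => ?_⟩, ?_⟩
  · obtain ⟨h1, h2⟩ := abs_linInterp_sub_bounds hr hlow hup (G.symm u) (G.symm v)
    change r * _ ≤ |G (G.symm u) - G (G.symm v)| at h1
    change |G (G.symm u) - G (G.symm v)| ≤ _ at h2
    rw [G.apply_symm_apply, G.apply_symm_apply] at h1 h2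
    set K := max 1 (max (2 * R) (1 / r))
    have hK : 0 < K := one_pos.trans_le (le_max_left _ _)
    have hRK : 2 * R ≤ K := (le_max_left _ _).trans (le_max_right _ _)
    have hrK : 1 / r ≤ K := (le_max_right _ _).trans (le_max_right _ _)
    constructor
    · rw [one_div_mul_eq_div, div_le_iff₀' hK]
      exact h2.trans (by gcongr)
    · calc |G.symm u - G.symm v| ≤ 1 / r * |u - v| := by
            rwa [one_div_mul_eq_div, le_div_iff₀' hr]
        _ ≤ K * |u - v| := by gcongr
  · ext x
    constructor
    · rintro ⟨y, hy, rfl⟩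
      obtain ⟨n, hn⟩ := e.surjective ⟨y, hy⟩
      exact ⟨n, G.symm_apply_eq.2 (by rw [hG, hn])⟩
    · rintro ⟨n, rfl⟩
      exact ⟨e n, (e n).2, G.symm_apply_eq.2 (hG n).symm⟩
end
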